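/- Let k be an algebraically closed field and G a finite group acting on kQ by permuting the primitive idempotents e_i and stabilizing the span M of the arrows. For i, j ∈ Ĩ, inside the skew group algebra (kQ)G one has the internal direct sum decomposition e_j (MG) e_i = ⊕_{(i',j') ∈ F_{ij}} G_j κ_{j'} M_{i'j'} κ_{i'}^{-1} G_i, where each summand is the linear span of products g κ_{j'} m κ_{i'}^{-1} h with g ∈ G_j, h ∈ G_i, m ∈ M_{i'j'}. -/

import Mathlib

open scoped TensorProduct
open CategoryTheory

noncomputable section

universe u

/-- A right action of a group `G` on a `k`-algebra `L` by `k`-algebra automorphisms,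
written `a ^ g = act.ρ g a`. -/
structure RightGAction (k : Type u) [CommRing k] (L : Type u) [Ring L] [Algebra k L]
    (G : Type u) [Group G] : Type u where
  ρ : G → L ≃ₐ[k] L
  ρ_one : ∀ a, ρ 1 a = a
  ρ_mul : ∀ g h a, ρ (g * h) a = ρ h (ρ g a)

/-- `A` is a skew group algebra `L G` for the right action `act` of `G` on `L`:
it contains `L` as a subalgebra, `G` as a subgroup of units satisfying
`g⁻¹ * a * g = a ^ g`, and is freely spanned by the products `a * g`;
this encodes the algebra `L ⊗ₖ k[G]` with `(a ⊗ g) * (a' ⊗ g') = a * (a' ^ g⁻¹) ⊗ g g'`. -/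
structure IsSkewGroupAlgebra {k L G : Type u} [CommRing k] [Ring L] [Algebra k L] [Group G]
    (act : RightGAction k L G) (A : Type u) [Ring A] [Algebra k A] : Type u where
  ι : L →ₐ[k] A
  γ : G →* Aˣ
  conj_eq : ∀ (g : G) (a : L), (↑(γ g)⁻¹ : A) * ι a * ↑(γ g) = ι (act.ρ g a)
  repr_exists : ∀ x : A, ∃ c : G →₀ L, x = c.sum fun g a => ι a * ↑(γ g)
  repr_unique : ∀ c d : G →₀ L,
    (c.sum fun g a => ι a * ↑(γ g)) = (d.sum fun g a => ι a * ↑(γ g)) → c = d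

/-- Paths in the quiver with arrow set `Arr`, source and target maps `src`, `tgt`. -/
inductive QPath {I Arr : Type u} (src tgt : Arr → I) : I → I → Type u
  | nil (i : I) : QPath src tgt i i
  | cons {i j l : I} (p : QPath src tgt i j) (a : Arr) (hs : src a = j) (ht : tgt a = l) :
      QPath src tgt i l

/-- The product, in an algebra `P`, of the arrows of a path (target-to-source order),
where `e` interprets the vertices and `arr` the arrows. -/
def pathProd {I Arr P : Type u} [Semiring P] {src tgt : Arr → I} (e : I → P) (arr : Arr → P)
    {i j : I} (p : QPath src tgt i j) : P :=
  match i, j, p with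
  | _, _, .nil i0 => e i0
  | _, _, .cons q a _ _ => arr a * pathProd e arr q

/-- `P` is the path algebra `kQ` of the quiver `Q = (I, Arr, src, tgt)`:
the vertices give a complete family of orthogonal idempotents `e i`, arrows give
elements `arr a` with `e (tgt a) * arr a * e (src a) = arr a`, and
the products of arrows along paths form a `k`-basis of `P`. -/
structure IsPathAlgebra (k : Type u) [CommRing k] {I Arr : Type u} [Fintype I]
    [DecidableEq I] (src tgt : Arr → I) (P : Type u) [Ring P] [Algebra k P] : Type u where
  e : I → P
  arr : Arr → P
  orth : ∀ i j, e i * e j = if i = j then e i else 0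
  sum_one : (∑ i, e i) = 1
  sandwich : ∀ a, e (tgt a) * arr a * e (src a) = arr a
  indep : LinearIndependent k
    (fun x : Σ i : I, Σ j : I, QPath src tgt i j => pathProd e arr x.2.2)
  span_top : Submodule.span k
    (Set.range fun x : Σ i : I, Σ j : I, QPath src tgt i j => pathProd e arr x.2.2) = ⊤

/-- An action of `G` on the path algebra `P` of a quiver permuting the primitive
idempotents (via the right action `π` on vertices) and stabilizing the span of the arrows. -/
structure ActionOnPathAlgebra (k : Type u) [CommRing k] {I Arr : Type u} [Fintype I]
    [DecidableEq I] (src tgt : Arr → I) (P : Type u) [Ring P] [Algebra k P]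
    (G : Type u) [Group G] : Type u where
  pa : IsPathAlgebra k src tgt P
  act : RightGAction k P G
  π : G → I → I
  π_one : ∀ i, π 1 i = i
  π_mul : ∀ g h i, π (g * h) i = π h (π g i)
  e_perm : ∀ g i, act.ρ g (pa.e i) = pa.e (π g i)
  arrows_stable : ∀ (g : G), ∀ x ∈ Submodule.span k (Set.range pa.arr),
    act.ρ g x ∈ Submodule.span k (Set.range pa.arr)

namespace ActionOnPathAlgebra

variable {k : Type u} [CommRing k] {I Arr : Type u} [Fintype I] [DecidableEq I]
  {src tgt : Arr → I} {P : Type u} [Ring P] [Algebra k P] {G : Type u} [Group G]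

/-- The stabilizer `G_i` of the primitive idempotent `e i`. -/
def Stab (S : ActionOnPathAlgebra k src tgt P G) (i : I) : Subgroup G where
  carrier := {g | S.π g i = i}
  one_mem' := S.π_one i
  mul_mem' := by
    intro a b ha hb
    simp only [Set.mem_setOf_eq] at *
    rw [S.π_mul, ha, hb]
  inv_mem' := by
    intro a ha
    simp only [Set.mem_setOf_eq] at *
    calc S.π a⁻¹ i = S.π a⁻¹ (S.π a i) := by rw [ha]
    _ = S.π (a * a⁻¹) i := (S.π_mul a a⁻¹ i).symm
    _ = i := by rw [mul_inv_cancel, S.π_one]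

@[simp] theorem mem_Stab (S : ActionOnPathAlgebra k src tgt P G) (i : I) (g : G) :
    g ∈ S.Stab i ↔ S.π g i = i := Iff.rfl

/-- The span `M_{i'j'}` of the arrows from `i'` to `j'`. -/
def Mij (S : ActionOnPathAlgebra k src tgt P G) (i' j' : I) : Submodule k P :=
  Submodule.span k {x | ∃ a : Arr, src a = i' ∧ tgt a = j' ∧ x = S.pa.arr a}

end ActionOnPathAlgebra

/-- Data of orbit representatives for a right action `π` of `G` on `I`:
`rep i` is the chosen representative `i∘` of the orbit of `i` and `κ i` is a group
element with `i∘ ^ (κ i) = i`. -/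
structure OrbitData {G I : Type u} [Group G] (π : G → I → I) : Type u where
  rep : I → I
  κ : I → G
  rep_rep : ∀ i, rep (rep i) = rep i
  rep_const : ∀ g i, rep (π g i) = rep i
  κ_spec : ∀ i, π (κ i) (rep i) = i

section conj

variable {k : Type u} [CommRing k] {I Arr : Type u} [Fintype I] [DecidableEq I]
  {src tgt : Arr → I} {P : Type u} [Ring P] [Algebra k P] {G : Type u} [Group G]

theorem conj_mem (S : ActionOnPathAlgebra k src tgt P G) (O : OrbitData S.π) {i' c : I}
    (hc : O.rep i' = c) {g : G} (hg : g ∈ S.Stab i') :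
    O.κ i' * g * (O.κ i')⁻¹ ∈ S.Stab c := by
  have h1 : S.π (O.κ i') c = i' := by rw [← hc]; exact O.κ_spec i'
  have hg' : S.π g i' = i' := hg
  have h2 : S.π (O.κ i' * g * (O.κ i')⁻¹) c = S.π (O.κ i')⁻¹ i' := by
    rw [S.π_mul, S.π_mul, h1, hg']
  have h3 : S.π (O.κ i')⁻¹ i' = c := by
    have h4 := S.π_mul (O.κ i') (O.κ i')⁻¹ c
    rw [mul_inv_cancel, S.π_one, h1] at h4
    exact h4.symm
  show S.π _ c = c
  rw [h2, h3]

/-- Conjugation by `κ i'`, as a group homomorphism from a subgroup `H ≤ G_{i'}`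
to the stabilizer `G_c` of the chosen representative `c` of the orbit of `i'`;
this implements the correspondence `G_{i'} = κ_{i'}⁻¹ G_{i∘} κ_{i'}`. -/
def conjHom (S : ActionOnPathAlgebra k src tgt P G) (O : OrbitData S.π) {i' c : I}
    (hc : O.rep i' = c) (H : Subgroup G) (hH : H ≤ S.Stab i') :
    H →* (S.Stab c) where
  toFun g := ⟨O.κ i' * ↑g * (O.κ i')⁻¹, conj_mem S O hc (hH g.2)⟩
  map_one' := by ext; simp
  map_mul' g h := by ext; simp only [Subgroup.coe_mul]; group

end conj

namespace IsSkewGroupAlgebra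

variable {k L G A : Type u} [CommRing k] [Ring L] [Algebra k L] [Group G]
  {act : RightGAction k L G} [Ring A] [Algebra k A]

theorem ι_mul_γ (sk : IsSkewGroupAlgebra act A) (a : L) (g : G) :
    sk.ι a * ↑(sk.γ g) = ↑(sk.γ g) * sk.ι (act.ρ g a) := by
  rw [← sk.conj_eq, ← mul_assoc, ← mul_assoc, Units.mul_inv, one_mul]

theorem γ_mul_ι (sk : IsSkewGroupAlgebra act A) (a : L) (g : G) :
    ↑(sk.γ g) * sk.ι a = sk.ι (act.ρ g⁻¹ a) * ↑(sk.γ g) := by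
  rw [sk.ι_mul_γ, ← act.ρ_mul, inv_mul_cancel, act.ρ_one]

/-- A linear endomorphism of `L` extends coefficientwise to the skew group algebra. -/
theorem exists_coeff_map (sk : IsSkewGroupAlgebra act A) (f : L →ₗ[k] L) :
    ∃ D : A →ₗ[k] A, ∀ a g, D (sk.ι a * ↑(sk.γ g)) = sk.ι (f a) * ↑(sk.γ g) := by
  let Φ : (G →₀ L) →ₗ[k] A := Finsupp.lsum k fun g =>
    (LinearMap.mulRight k (↑(sk.γ g) : A)).comp sk.ι.toLinearMap
  have hΦ : ∀ c, Φ c = c.sum fun g a => sk.ι a * ↑(sk.γ g) := fun _ => rfl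
  have hbij : Function.Bijective Φ := by
    refine ⟨fun c d h => sk.repr_unique c d ?_, fun x => ?_⟩
    · rwa [hΦ, hΦ] at h
    · obtain ⟨c, hc⟩ := sk.repr_exists x
      exact ⟨c, hc.symm⟩
  have hsingle : ∀ g a, Φ (Finsupp.single g a) = sk.ι a * ↑(sk.γ g) := fun g a => by
    rw [hΦ]; exact Finsupp.sum_single_index (by simp)
  let E := LinearEquiv.ofBijective Φ hbij
  refine ⟨Φ ∘ₗ Finsupp.mapRange.linearMap f ∘ₗ E.symm.toLinearMap, fun a g => ?_⟩
  have hE : E.symm (sk.ι a * ↑(sk.γ g)) = Finsupp.single g a := by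
    rw [LinearEquiv.symm_apply_eq]
    exact (hsingle g a).symm
  simp [hE, hsingle]

end IsSkewGroupAlgebra

theorem IsPathAlgebra.e_mul_arr_mul_e {k I Arr P : Type u} [CommRing k] [Fintype I]
    [DecidableEq I] {src tgt : Arr → I} [Ring P] [Algebra k P]
    (pa : IsPathAlgebra k src tgt P) (s t : I) (a : Arr) :
    pa.e t * pa.arr a * pa.e s = if src a = s ∧ tgt a = t then pa.arr a else 0 := by
  have h : pa.e t * pa.arr a * pa.e s
      = (pa.e t * pa.e (tgt a)) * pa.arr a * (pa.e (src a) * pa.e s) := by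
    conv_lhs => rw [← pa.sandwich a]
    simp only [mul_assoc]
  rw [h, pa.orth, pa.orth]
  by_cases ht : t = tgt a
  · by_cases hs : src a = s
    · subst ht hs
      simp [pa.sandwich]
    · simp [hs]
  · simp [ht, Ne.symm ht]

namespace ActionOnPathAlgebra

variable {k : Type u} [CommRing k] {I Arr : Type u} [Fintype I] [DecidableEq I]
  {src tgt : Arr → I} {P : Type u} [Ring P] [Algebra k P] {G : Type u} [Group G]

theorem π_inv (S : ActionOnPathAlgebra k src tgt P G) {g : G} {a b : I} (h : S.π g a = b) :
    S.π g⁻¹ b = a := by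
  rw [← h, ← S.π_mul, mul_inv_cancel, S.π_one]

theorem mem_Mij_iff (S : ActionOnPathAlgebra k src tgt P G) {s t : I} {m : P} :
    m ∈ S.Mij s t ↔
      m ∈ Submodule.span k (Set.range S.pa.arr) ∧ S.pa.e t * m * S.pa.e s = m := by
  constructor
  · intro hm
    refine ⟨Submodule.span_mono ?_ hm, ?_⟩
    · rintro _ ⟨a, -, -, rfl⟩
      exact ⟨a, rfl⟩
    · induction hm using Submodule.span_induction with
      | mem x hx =>
        obtain ⟨a, hs, ht, rfl⟩ := hx
        rw [S.pa.e_mul_arr_mul_e, if_pos ⟨hs, ht⟩]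
      | zero => simp
      | add x y _ _ hx hy => rw [mul_add, add_mul, hx, hy]
      | smul c x _ hx => rw [mul_smul_comm, smul_mul_assoc, hx]
  · rintro ⟨hm, h⟩
    rw [← h]
    clear h
    induction hm using Submodule.span_induction with
    | mem x hx =>
      obtain ⟨a, rfl⟩ := hx
      rw [S.pa.e_mul_arr_mul_e]
      split_ifs with hst
      · exact Submodule.subset_span ⟨a, hst.1, hst.2, rfl⟩
      · exact zero_mem _
    | zero => simp
    | add x y _ _ hx hy => rw [mul_add, add_mul]; exact add_mem hx hy
    | smul c x _ hx => rw [mul_smul_comm, smul_mul_assoc]; exact Submodule.smul_mem _ _ hx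

theorem ρ_mem_Mij (S : ActionOnPathAlgebra k src tgt P G) {s t : I} {m : P}
    (hm : m ∈ S.Mij s t) (g : G) : S.act.ρ g m ∈ S.Mij (S.π g s) (S.π g t) := by
  rw [mem_Mij_iff] at hm ⊢
  refine ⟨S.arrows_stable g m hm.1, ?_⟩
  rw [← S.e_perm, ← S.e_perm, ← map_mul, ← map_mul, hm.2]

theorem γ_mul_ι_mul_γ_mem_span (S : ActionOnPathAlgebra k src tgt P G) {A : Type u} [Ring A]
    [Algebra k A] (sk : IsSkewGroupAlgebra S.act A) {m : P}
    (hm : m ∈ Submodule.span k (Set.range S.pa.arr)) (u v : G) :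
    (↑(sk.γ u) * sk.ι m * ↑(sk.γ v) : A) ∈ Submodule.span k
      {x : A | ∃ (a : Arr) (g : G), x = sk.ι (S.pa.arr a) * ↑(sk.γ g)} := by
  rw [sk.γ_mul_ι, mul_assoc, ← Units.val_mul, ← map_mul]
  have hm' := S.arrows_stable u⁻¹ m hm
  generalize S.act.ρ u⁻¹ m = n at hm'
  induction hm' using Submodule.span_induction with
  | mem x hx =>
    obtain ⟨a, rfl⟩ := hx
    exact Submodule.subset_span ⟨a, _, rfl⟩
  | zero => simp
  | add x y _ _ hx hy => rw [map_add, add_mul]; exact add_mem hx hy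
  | smul c x _ hx => rw [map_smul, smul_mul_assoc]; exact Submodule.smul_mem _ _ hx

/-- The products `g κ_{j'} m κ_{i'}⁻¹ h` are the products `u m v` with `j ^ u = j'` and
`i' ^ v = i`. -/
theorem setOf_stab_mul_eq (S : ActionOnPathAlgebra k src tgt P G) (O : OrbitData S.π)
    {A : Type u} [Ring A] [Algebra k A] (sk : IsSkewGroupAlgebra S.act A) {i j i' j' : I}
    (hi : O.rep i' = i) (hj : O.rep j' = j) :
    {x : A | ∃ g ∈ S.Stab j, ∃ h ∈ S.Stab i, ∃ m ∈ S.Mij i' j',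
      x = ↑(sk.γ g) * ↑(sk.γ (O.κ j')) * sk.ι m * ↑(sk.γ (O.κ i'))⁻¹ * ↑(sk.γ h)} =
    {x : A | ∃ u v : G, S.π u j = j' ∧ S.π v i' = i ∧ ∃ m ∈ S.Mij i' j',
      x = ↑(sk.γ u) * sk.ι m * ↑(sk.γ v)} := by
  have hκi : S.π (O.κ i') i = i' := hi ▸ O.κ_spec i'
  have hκj : S.π (O.κ j') j = j' := hj ▸ O.κ_spec j'
  ext x
  constructor
  · rintro ⟨g, hg, h, hh, m, hm, rfl⟩
    rw [mem_Stab] at hg hh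
    refine ⟨g * O.κ j', (O.κ i')⁻¹ * h, ?_, ?_, m, hm, ?_⟩
    · rw [S.π_mul, hg, hκj]
    · rw [S.π_mul, S.π_inv hκi, hh]
    · simp only [map_mul, map_inv, Units.val_mul, mul_assoc]
  · rintro ⟨u, v, hu, hv, m, hm, rfl⟩
    refine ⟨u * (O.κ j')⁻¹, ?_, O.κ i' * v, ?_, m, hm, ?_⟩
    · rw [mem_Stab, S.π_mul, hu, S.π_inv hκj]
    · rw [mem_Stab, S.π_mul, hκi, hv]
    · simp only [map_mul, map_inv, Units.val_mul, mul_assoc, Units.inv_mul_cancel_left]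

open Classical in
/-- The projection of the path algebra onto the span of the paths whose (source, target)
lies in the orbit of `p`. -/
def orbitProj (S : ActionOnPathAlgebra k src tgt P G) (p : I × I) : P →ₗ[k] P :=
  ∑ q : I × I, if ∃ g, S.π g p.1 = q.1 ∧ S.π g p.2 = q.2 then
    (LinearMap.mulLeft k (S.pa.e q.2)).comp (LinearMap.mulRight k (S.pa.e q.1)) else 0

open Classical in
theorem orbitProj_apply (S : ActionOnPathAlgebra k src tgt P G) (p : I × I) {s t : I} {m : P}
    (hm : m ∈ S.Mij s t) :
    S.orbitProj p m = if ∃ g, S.π g p.1 = s ∧ S.π g p.2 = t then m else 0 := by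
  have hm := (S.mem_Mij_iff.1 hm).2
  have key : ∀ q : I × I,
      S.pa.e q.2 * (m * S.pa.e q.1) = if q = (s, t) then m else 0 := by
    rintro ⟨s', t'⟩
    have h : S.pa.e t' * (m * S.pa.e s')
        = (S.pa.e t' * S.pa.e t) * m * (S.pa.e s * S.pa.e s') := by
      conv_lhs => rw [← hm]
      simp only [mul_assoc]
    rw [h, S.pa.orth, S.pa.orth]
    by_cases ht : t' = t
    · by_cases hs : s = s'
      · subst ht hs
        simp [hm]
      · simp [hs, Ne.symm hs]
    · simp [ht]
  rw [orbitProj, LinearMap.sum_apply, Finset.sum_eq_single (s, t)]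
  · split_ifs
    · simpa using key (s, t)
    · rfl
  · intro q _ hq
    split_ifs
    · simpa [hq] using key q
    · rfl
  · simp

end ActionOnPathAlgebra

/-- **Decomposition of `e_j (MG) e_i`.** Let `G` act on the path algebra `kQ` of `Q`
permuting the primitive idempotents and stabilizing the span `M` of the arrows, and let
`A = (kQ)G` be the skew group algebra. For orbit representatives `i, j`, the subspace
`e_j (MG) e_i` of `A` is the internal direct sum, over the chosen representatives
`(i', j') ∈ F_{ij}` of the orbits of `G` on `O_i × O_j`, of the subspaces
`G_j κ_{j'} M_{i'j'} κ_{i'}⁻¹ G_i` spanned by the products `g κ_{j'} m κ_{i'}⁻¹ h`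
with `g ∈ G_j`, `h ∈ G_i` and `m ∈ M_{i'j'}`. -/
theorem ejMGei_direct_sum_decomposition
    (k : Type u) [Field k] [IsAlgClosed k] (G : Type u) [Group G] [Fintype G]
    (I Arr : Type u) [Fintype I] [DecidableEq I] (src tgt : Arr → I)
    (P : Type u) [Ring P] [Algebra k P]
    (S : ActionOnPathAlgebra k src tgt P G) (O : OrbitData S.π)
    (F : I → I → Finset (I × I))
    (F_mem : ∀ i j p, p ∈ F i j → O.rep p.1 = i ∧ O.rep p.2 = j)
    (F_repr : ∀ i j i' j', O.rep i' = i → O.rep j' = j →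
      ∃! p, p ∈ F i j ∧ ∃ g : G, S.π g p.1 = i' ∧ S.π g p.2 = j')
    (A : Type u) [Ring A] [Algebra k A] (sk : IsSkewGroupAlgebra S.act A)
    (i j : I) (hi : O.rep i = i) (hj : O.rep j = j) :
    ∀ (MG : Submodule k A) (Summand : I × I → Submodule k A),
      MG = Submodule.span k
        {x : A | ∃ (a : Arr) (g : G), x = sk.ι (S.pa.arr a) * ↑(sk.γ g)} →
      (∀ p : I × I, Summand p = Submodule.span k
        {x : A | ∃ g ∈ S.Stab j, ∃ h ∈ S.Stab i, ∃ m ∈ S.Mij p.1 p.2,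
          x = ↑(sk.γ g) * ↑(sk.γ (O.κ p.2)) * sk.ι m * ↑(sk.γ (O.κ p.1))⁻¹ * ↑(sk.γ h)}) →
      -- `e_j (MG) e_i` is the (direct) sum of the `Summand p`, `p ∈ F i j` :
      MG.map ((LinearMap.mulLeft k (sk.ι (S.pa.e j))).comp
          (LinearMap.mulRight k (sk.ι (S.pa.e i)))) =
        (⨆ p ∈ F i j, Summand p) ∧
      iSupIndep (fun p : ↥(F i j) => Summand ↑p) := by
  intro MG Summand hMG hSummand
  have hS : ∀ p ∈ F i j, Summand p = Submodule.span k
      {x : A | ∃ u v : G, S.π u j = p.2 ∧ S.π v p.1 = i ∧ ∃ m ∈ S.Mij p.1 p.2,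
        x = ↑(sk.γ u) * sk.ι m * ↑(sk.γ v)} := fun p hp => by
    rw [hSummand, S.setOf_stab_mul_eq O sk (F_mem i j p hp).1 (F_mem i j p hp).2]
  refine ⟨le_antisymm ?_ ?_, ?_⟩
  · rw [hMG, Submodule.map_span_le]
    rintro _ ⟨a, g, rfl⟩
    set s := S.π g⁻¹ i with hs
    have hcomp : sk.ι (S.pa.e j) * (sk.ι (S.pa.arr a) * ↑(sk.γ g) * sk.ι (S.pa.e i))
        = sk.ι (S.pa.e j * S.pa.arr a * S.pa.e s) * ↑(sk.γ g) := by
      rw [mul_assoc (sk.ι (S.pa.arr a)), sk.γ_mul_ι, S.e_perm]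
      simp only [map_mul, mul_assoc, hs]
    rw [LinearMap.comp_apply, LinearMap.mulRight_apply, LinearMap.mulLeft_apply, hcomp,
      S.pa.e_mul_arr_mul_e]
    split_ifs with hst
    swap
    · simp
    obtain ⟨p, ⟨hp, x, hx1, hx2⟩, -⟩ := F_repr i j s j (by rw [hs, O.rep_const, hi]) hj
    refine Submodule.mem_iSup_of_mem p (Submodule.mem_iSup_of_mem hp ?_)
    rw [hS p hp]
    refine Submodule.subset_span ⟨x⁻¹, x * g, S.π_inv hx2, ?_,
      S.act.ρ x⁻¹ (S.pa.arr a), ?_, ?_⟩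
    · rw [S.π_mul, hx1, hs, ← S.π_mul, inv_mul_cancel, S.π_one]
    · have ha : S.pa.arr a ∈ S.Mij s j := Submodule.subset_span ⟨a, hst.1, hst.2, rfl⟩
      simpa only [S.π_inv hx1, S.π_inv hx2] using S.ρ_mem_Mij ha x⁻¹
    · rw [sk.γ_mul_ι, ← S.act.ρ_mul, mul_inv_cancel, S.act.ρ_one, mul_assoc,
        ← Units.val_mul, ← map_mul, inv_mul_cancel_left]
  · refine iSup₂_le fun p hp => ?_
    rw [hS p hp, Submodule.span_le]
    rintro _ ⟨u, v, hu, hv, m, hm, rfl⟩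
    have hm' := S.mem_Mij_iff.1 hm
    refine ⟨_, hMG ▸ S.γ_mul_ι_mul_γ_mem_span sk hm'.1 u v, ?_⟩
    rw [LinearMap.comp_apply, LinearMap.mulRight_apply, LinearMap.mulLeft_apply,
      mul_assoc _ _ (sk.ι (S.pa.e i)), sk.γ_mul_ι _ v, S.e_perm, S.π_inv hv, ← mul_assoc,
      ← mul_assoc, ← mul_assoc, sk.ι_mul_γ, S.e_perm, hu]
    conv_rhs => rw [← hm'.2]
    simp only [map_mul, mul_assoc]
  · have hD : ∀ p : I × I, ∃ D : A →ₗ[k] A, ∀ a g,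
        D (sk.ι a * ↑(sk.γ g)) = sk.ι (S.orbitProj p a) * ↑(sk.γ g) :=
      fun p => sk.exists_coeff_map (S.orbitProj p)
    choose D hD using hD
    classical
    have hgen : ∀ (p q : I × I) (u v : G) (m : P), S.π u j = q.2 → m ∈ S.Mij q.1 q.2 →
        D p (↑(sk.γ u) * sk.ι m * ↑(sk.γ v)) =
          if ∃ g, S.π g p.1 = S.π u⁻¹ q.1 ∧ S.π g p.2 = S.π u⁻¹ q.2 then
            ↑(sk.γ u) * sk.ι m * ↑(sk.γ v) else 0 := by
      intro p q u v m hu hm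
      rw [sk.γ_mul_ι, mul_assoc, ← Units.val_mul, ← map_mul, hD,
        S.orbitProj_apply p (S.ρ_mem_Mij hm u⁻¹)]
      split_ifs <;> simp
    have hself : ∀ p ∈ F i j, ∀ x ∈ Summand p, D p x = x := by
      intro p hp x hx
      rw [hS p hp] at hx
      refine LinearMap.eqOn_span (g := LinearMap.id) ?_ hx
      rintro _ ⟨u, v, hu, hv, m, hm, rfl⟩
      rw [hgen p p u v m hu hm, if_pos ⟨u⁻¹, rfl, rfl⟩, LinearMap.id_apply]
    have hother : ∀ p ∈ F i j, ∀ q ∈ F i j, q ≠ p → Summand q ≤ LinearMap.ker (D p) := by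
      intro p hp q hq hne
      rw [hS q hq, Submodule.span_le]
      rintro _ ⟨u, v, hu, hv, m, hm, rfl⟩
      rw [SetLike.mem_coe, LinearMap.mem_ker, hgen p q u v m hu hm, if_neg]
      intro hg
      obtain ⟨hq1, hq2⟩ := F_mem i j q hq
      exact hne ((F_repr i j (S.π u⁻¹ q.1) (S.π u⁻¹ q.2) (by rw [O.rep_const, hq1])
        (by rw [O.rep_const, hq2])).unique ⟨hq, u⁻¹, rfl, rfl⟩ ⟨hp, hg⟩)
    intro p
    rw [Submodule.disjoint_def]
    intro x hx hx'
    have hker : (⨆ (q : ↥(F i j)) (_ : q ≠ p), Summand ↑q) ≤ LinearMap.ker (D p) :=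
      iSup₂_le fun q hq => hother p p.2 q q.2 fun h => hq (Subtype.ext h)
    rw [← hself p p.2 x hx]
    exact hker hx'
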